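/- Let d be a real number with 0 ≤ d < 1/2. Then the iterated integral ∫₀¹∫₀^{y₁}∫₀^{y₂}∫₀^{y₃}∫₀^{y₄} (y₁−y₃)^(−d)(y₂−y₃)^(−d)(y₁−y₄)^(−d)(y₂−y₅)^(−d)(y₄−y₅)^(−d) dy₅ dy₄ dy₃ dy₂ dy₁ equals (Γ(1−d)/(2(1−d)²))·(Γ(3−3d)·Γ(4−5d)/(Γ(4−4d)·Γ(6−5d)))·₄F₃(1, d, 2−2d, 3−3d; 2−d, 3−2d, 4−4d; 1). -/

import Mathlib

open Real

noncomputable def poch (a : ℝ) (k : ℕ) : ℝ := ∏ i ∈ Finset.range k, (a + i)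

noncomputable def F21 (a b c x : ℝ) : ℝ :=
  ∑' k : ℕ, poch a k * poch b k / (poch c k * (Nat.factorial k : ℝ)) * x ^ k

noncomputable def F32 (a b c e f : ℝ) : ℝ :=
  ∑' k : ℕ, poch a k * poch b k * poch c k / (poch e k * poch f k * (Nat.factorial k : ℝ))

noncomputable def F32x (a b c e f x : ℝ) : ℝ :=
  ∑' k : ℕ, poch a k * poch b k * poch c k / (poch e k * poch f k * (Nat.factorial k : ℝ)) * x ^ k

noncomputable def F43 (a b c g e f h : ℝ) : ℝ :=
  ∑' k : ℕ, poch a k * poch b k * poch c k * poch g k /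
    (poch e k * poch f k * poch h k * (Nat.factorial k : ℝ))

open MeasureTheory Set

lemma poch_succ' (a : ℝ) (k : ℕ) : poch a (k+1) = poch a k * (a + k) := by
  simp [poch, Finset.prod_range_succ]

lemma poch_pos' {a : ℝ} (ha : 0 < a) (k : ℕ) : 0 < poch a k :=
  Finset.prod_pos fun i _ => by positivity

lemma poch_nonneg' {a : ℝ} (ha : 0 ≤ a) (k : ℕ) : 0 ≤ poch a k :=
  Finset.prod_nonneg fun i _ => by positivity

lemma choose_poch (a : ℝ) (n : ℕ) : Ring.choose (a + n - 1) n = poch a n / (n.factorial : ℝ) := by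
  have h : Ring.choose (a + n - 1) n = Ring.multichoose a n := by
    unfold Ring.choose; congr 1; ring
  have h2 := Ring.factorial_nsmul_multichoose_eq_ascPochhammer a n
  have h3 : (ascPochhammer ℕ n).smeval a = poch a n := by
    rw [Polynomial.ascPochhammer_smeval_eq_eval]
    induction n with
    | zero => simp [poch]
    | succ k ih => 
      rw [ascPochhammer_succ_eval, ih, poch_succ']
      · unfold Ring.choose; congr 1; ring
      · exact Ring.factorial_nsmul_multichoose_eq_ascPochhammer a k
  rw [h3, nsmul_eq_mul] at h2
  rw [h, ← h2]; field_simp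

lemma binom_series (a z : ℝ) (hz : 0 ≤ z) (hz1 : z < 1) :
    HasSum (fun k : ℕ => poch a k / (k.factorial : ℝ) * z ^ k) ((1 - z) ^ (-a)) := by
  have h := (Real.one_div_one_sub_rpow_hasFPowerSeriesOnBall_zero a).hasSum (y := z)
    (by
      rw [Metric.mem_eball, edist_zero_right, ← ofReal_norm, norm_eq_abs, abs_of_nonneg hz]
      simpa using hz1)
  simp only [FormalMultilinearSeries.ofScalars_apply_eq, zero_add, smul_eq_mul, choose_poch] at h
  rw [rpow_neg (by linarith), ← one_div]
  exact h

lemma lbeta {a b c : ℝ} (ha : 0 < a) (hb : 0 < b) (hc : 0 < c) :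
    ∫⁻ x in Ioo 0 c, ENNReal.ofReal (x ^ (a-1) * (c - x) ^ (b-1)) =
      ENNReal.ofReal (c ^ (a+b-1) * ProbabilityTheory.beta a b) := by
  have hB := ProbabilityTheory.beta_pos ha hb
  have him : (fun x => c * x) '' Ioo 0 1 = Ioo 0 c := by
    rw [image_mul_left_Ioo hc]; simp
  rw [← him, lintegral_image_eq_lintegral_abs_deriv_mul (f' := fun _ => c) (measurableSet_Ioo (a := (0:ℝ)) (b := 1))
    (fun x _ => by simpa using ((hasDerivAt_id x).const_mul c).hasDerivWithinAt)
    (fun x _ y _ h => mul_left_cancel₀ hc.ne' h)]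
  have h1 := ProbabilityTheory.lintegral_betaPDF_eq_one ha hb
  rw [ProbabilityTheory.lintegral_betaPDF] at h1
  rw [← mul_one (ENNReal.ofReal (c ^ _ * _)), ← h1, ← lintegral_const_mul _ (by fun_prop)]
  refine setLIntegral_congr_fun measurableSet_Ioo fun x hx => ?_
  have h2 : 0 < 1 - x := by linarith [hx.2]
  rw [← ENNReal.ofReal_mul (by positivity), ← ENNReal.ofReal_mul (by positivity)]
  congr 1
  rw [show c - c * x = c * (1 - x) by ring, mul_rpow hc.le hx.1.le, mul_rpow hc.le h2.le,
    abs_of_pos hc, show a + b - 1 = 1 + (a-1) + (b-1) by ring, rpow_add hc, rpow_add hc, rpow_one]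
  field_simp

lemma lev (F : ℝ → ENNReal) (K : ℕ → ENNReal) (a : ℕ → ℝ) (b c : ℝ) (hc : 0 < c) (hb : 0 < b)
    (ha : ∀ k, 0 < a k)
    (hF : ∀ x ∈ Ioo 0 c, F x = ∑' k, K k * ENNReal.ofReal (x ^ (a k - 1) * (c - x) ^ (b-1)))
    (h0 : ∀ x, x ∉ Ioo 0 c → F x = 0) :
    ∫⁻ x, F x = ∑' k, K k * ENNReal.ofReal (c ^ (a k+b-1) * ProbabilityTheory.beta (a k) b) := by
  have : F = (Ioo 0 c).indicator F := by
    ext x; by_cases h : x ∈ Ioo 0 c <;> simp [h, h0]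
  rw [this, lintegral_indicator measurableSet_Ioo, setLIntegral_congr_fun measurableSet_Ioo hF,
    lintegral_tsum (fun k => by fun_prop)]
  congr 1; ext k
  rw [lintegral_const_mul _ (by fun_prop), lbeta (ha k) hb hc]

lemma step (r : ℝ → ℝ) (l : ℝ → ENNReal) (b : ℝ) (hb : 0 ≤ b) (hl : Measurable l)
    (h : ∀ x ∈ Ioo 0 b, l x < ⊤ → r x = (l x).toReal)
    (h0 : ∀ x, x ∉ Ioo 0 b → l x = 0) (hfin : ∫⁻ x, l x < ⊤) :
    ∫ x in (0:ℝ)..b, r x = (∫⁻ x, l x).toReal := by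
  have e : ∫⁻ x, l x = ∫⁻ x in Ioo 0 b, l x := by
    conv_lhs => rw [show l = (Ioo 0 b).indicator l by
      ext x; by_cases h : x ∈ Ioo 0 b <;> simp [h, h0]]
    rw [lintegral_indicator measurableSet_Ioo]
  rw [e] at hfin ⊢
  have hae := ae_lt_top hl hfin.ne
  rw [intervalIntegral.integral_of_le hb, integral_Ioc_eq_integral_Ioo,
    ← integral_toReal hl.aemeasurable hae]
  apply integral_congr_ae
  filter_upwards [hae, ae_restrict_mem measurableSet_Ioo] with x hx hx2
  exact h x hx2 hx

lemma reflI (F : ℝ → ENNReal) (c : ℝ) : ∫⁻ x, F x = ∫⁻ x, F (c - x) :=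
  (lintegral_sub_left_eq_self F c).symm

lemma swap4 (F : ℝ → ℝ → ℝ → ℝ → ENNReal)
    (hF : Measurable fun p : ℝ × ℝ × ℝ × ℝ => F p.1 p.2.1 p.2.2.1 p.2.2.2) :
    ∫⁻ a, ∫⁻ b, ∫⁻ c, ∫⁻ e, F a b c e = ∫⁻ e, ∫⁻ c, ∫⁻ b, ∫⁻ a, F a b c e := by
  have s1 : ∀ a b, ∫⁻ c, ∫⁻ e, F a b c e = ∫⁻ e, ∫⁻ c, F a b c e := fun a b =>
    lintegral_lintegral_swap
      (hF.comp (f := fun p : ℝ × ℝ => (a, b, p.1, p.2)) (by fun_prop)).aemeasurable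
  have s2 : ∀ a, ∫⁻ b, ∫⁻ e, ∫⁻ c, F a b c e = ∫⁻ e, ∫⁻ b, ∫⁻ c, F a b c e := fun a => by
    apply lintegral_lintegral_swap
    exact (Measurable.lintegral_prod_right' (f := fun p : (ℝ × ℝ) × ℝ => F a p.1.1 p.2 p.1.2)
      (hF.comp (f := fun p : (ℝ × ℝ) × ℝ => (a, p.1.1, p.2, p.1.2)) (by fun_prop))).aemeasurable
  have s3 : ∀ a e, ∫⁻ b, ∫⁻ c, F a b c e = ∫⁻ c, ∫⁻ b, F a b c e := fun a e =>
    lintegral_lintegral_swap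
      (hF.comp (f := fun p : ℝ × ℝ => (a, p.1, p.2, e)) (by fun_prop)).aemeasurable
  have s4 : ∫⁻ a, ∫⁻ e, ∫⁻ c, ∫⁻ b, F a b c e = ∫⁻ e, ∫⁻ a, ∫⁻ c, ∫⁻ b, F a b c e := by
    apply lintegral_lintegral_swap
    apply Measurable.aemeasurable
    apply Measurable.lintegral_prod_right' (f := fun p : (ℝ × ℝ) × ℝ => ∫⁻ b, F p.1.1 b p.2 p.1.2)
    exact Measurable.lintegral_prod_right'
      (f := fun p : ((ℝ × ℝ) × ℝ) × ℝ => F p.1.1.1 p.2 p.1.2 p.1.1.2)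
      (hF.comp (f := fun p : ((ℝ × ℝ) × ℝ) × ℝ => (p.1.1.1, p.2, p.1.2, p.1.1.2)) (by fun_prop))
  have s5 : ∀ e, ∫⁻ a, ∫⁻ c, ∫⁻ b, F a b c e = ∫⁻ c, ∫⁻ a, ∫⁻ b, F a b c e := fun e => by
    apply lintegral_lintegral_swap
    exact (Measurable.lintegral_prod_right' (f := fun p : (ℝ × ℝ) × ℝ => F p.1.1 p.2 p.1.2 e)
      (hF.comp (f := fun p : (ℝ × ℝ) × ℝ => (p.1.1, p.2, p.1.2, e)) (by fun_prop))).aemeasurable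
  have s6 : ∀ e c, ∫⁻ a, ∫⁻ b, F a b c e = ∫⁻ b, ∫⁻ a, F a b c e := fun e c =>
    lintegral_lintegral_swap
      (hF.comp (f := fun p : ℝ × ℝ => (p.1, p.2, c, e)) (by fun_prop)).aemeasurable
  simp_rw [s1, s2, s3]
  rw [s4]
  simp_rw [s5, s6]

lemma beta_one' {a : ℝ} (ha : 0 < a) : ProbabilityTheory.beta a 1 = 1 / a := by
  have := Gamma_pos_of_pos ha
  rw [ProbabilityTheory.beta, Gamma_add_one ha.ne', Gamma_one]
  field_simp

lemma Gamma_poch {a : ℝ} (ha : 0 < a) (k : ℕ) : Gamma (a + k) = poch a k * Gamma a := by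
  induction k with
  | zero => simp [poch]
  | succ k ih =>
    rw [show a + ((k+1 : ℕ) : ℝ) = (a + k) + 1 by push_cast; ring, Gamma_add_one (by positivity), ih,
      poch_succ']
    ring

lemma poch_ratio {a : ℝ} (ha : 0 < a) (k : ℕ) : poch a k / poch (a+1) k = a / (a + k) := by
  have h1 := Gamma_poch ha k
  have h2 := Gamma_poch (a := a+1) (by linarith) k
  rw [show a + 1 + (k:ℝ) = (a + k) + 1 by ring, Gamma_add_one (by positivity), h1,
    Gamma_add_one ha.ne'] at h2
  have := Gamma_pos_of_pos ha
  have h3 := poch_pos' (a := a+1) (by linarith) k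
  have h4 : (a + k) * poch a k = poch (a+1) k * a := by
    apply mul_right_cancel₀ this.ne'; linarith
  field_simp
  linarith

lemma poch_mono {a b : ℝ} (ha : 0 ≤ a) (hab : a ≤ b) (k : ℕ) : poch a k ≤ poch b k :=
  Finset.prod_le_prod (fun i _ => by positivity) (fun i _ => by linarith)

noncomputable def tm (d : ℝ) (k : ℕ) : ℝ :=
  poch 1 k * poch d k * poch (2-2*d) k * poch (3-3*d) k /
    (poch (2-d) k * poch (3-2*d) k * poch (4-4*d) k * (Nat.factorial k : ℝ))

lemma poch_one' (k : ℕ) : poch 1 k = (k.factorial : ℝ) := by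
  have := Gamma_poch one_pos k
  rw [Gamma_one, mul_one, add_comm, Gamma_nat_eq_factorial] at this
  exact this.symm

lemma tm_nonneg {d : ℝ} (h0 : 0 ≤ d) (h1 : d < 1/2) (k : ℕ) : 0 ≤ tm d k := by
  have := poch_nonneg' h0 k
  have := poch_nonneg' (a := 1) (by linarith) k
  have := poch_nonneg' (a := 2-2*d) (by linarith) k
  have := poch_nonneg' (a := 3-3*d) (by linarith) k
  have := poch_nonneg' (a := 2-d) (by linarith) k
  have := poch_nonneg' (a := 3-2*d) (by linarith) k
  have := poch_nonneg' (a := 4-4*d) (by linarith) k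
  unfold tm; positivity

lemma tm_summable {d : ℝ} (h0 : 0 ≤ d) (h1 : d < 1/2) : Summable (tm d) := by
  have hs : Summable (fun k : ℕ => 2 * (1 / ((k:ℝ)+1)^2)) := by
    apply Summable.mul_left
    have := (summable_nat_add_iff 1).2 (Real.summable_one_div_nat_pow.2 (one_lt_two))
    simpa using this
  refine Summable.of_nonneg_of_le (tm_nonneg h0 h1) (fun k => ?_) hs
  have q0 := poch_nonneg' h0 k
  have q1 := poch_pos' (a := 2-2*d) (by linarith) k
  have q2 := poch_pos' (a := 3-3*d) (by linarith) k
  have q3 := poch_pos' (a := 2-d) (by linarith) k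
  have q4 := poch_pos' (a := 3-2*d) (by linarith) k
  have q5 := poch_pos' (a := 4-4*d) (by linarith) k
  have q6 := poch_pos' (a := 1/2) (by linarith) k
  have q7 := poch_pos' (a := 1/2+1) (by linarith) k
  have r1 := poch_ratio (a := 2-2*d) (by linarith) k
  rw [show 2 - 2*d + 1 = 3 - 2*d by ring] at r1
  have r2 := poch_ratio (a := 1/2) (by linarith) k
  have r3 : poch (3-3*d) k / poch (4-4*d) k ≤ 1 :=
    (div_le_one q5).2 (poch_mono (by linarith) (by linarith) k)
  have r4 : poch d k / poch (2-d) k ≤ poch (1/2) k / poch (1/2+1) k :=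
    div_le_div₀ q6.le (poch_mono h0 (by linarith) k) q7 (poch_mono (by linarith) (by linarith) k)
  have hk : (0:ℝ) ≤ k := by positivity
  have r5 : (1/2 : ℝ)/(1/2 + k) ≤ 1/(k+1) := by
    rw [div_le_div_iff₀ (by positivity) (by positivity)]; linarith
  have r6 : (2-2*d)/(2-2*d+k) ≤ 2/(k+1) := by
    rw [div_le_div_iff₀ (by nlinarith) (by positivity)]; nlinarith
  have e : tm d k = (poch d k / poch (2-d) k) * (poch (2-2*d) k / poch (3-2*d) k) *
      (poch (3-3*d) k / poch (4-4*d) k) := by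
    unfold tm; rw [poch_one']; field_simp
  rw [e, r1]
  rw [r2] at r4
  calc _ ≤ 1/((k:ℝ)+1) * (2/(k+1)) * 1 := by
        have : 0 ≤ (2-2*d)/(2-2*d+k) := div_nonneg (by linarith) (by linarith)
        have p : 0 ≤ poch (3-3*d) k / poch (4-4*d) k := by positivity
        exact mul_le_mul (mul_le_mul (r4.trans r5) r6 this (by positivity)) r3 p (by positivity)
    _ = _ := by field_simp

noncomputable def cf (d : ℝ) (k : ℕ) : ℝ := poch d k / (k.factorial : ℝ)
noncomputable def b1 (d : ℝ) (k : ℕ) : ℝ := ProbabilityTheory.beta (k+1) (1-d)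
noncomputable def b2 (d : ℝ) (k : ℕ) : ℝ := ProbabilityTheory.beta (k+2-2*d) 1
noncomputable def b3 (d : ℝ) (k : ℕ) : ℝ := ProbabilityTheory.beta (k+3-3*d) (1-d)
noncomputable def b4 (d : ℝ) : ℝ := ProbabilityTheory.beta (4-5*d) 1
noncomputable def b5 (d : ℝ) : ℝ := ProbabilityTheory.beta (5-5*d) 1

lemma term_eq {d : ℝ} (h0 : 0 ≤ d) (h1 : d < 1/2) (k : ℕ) :
    cf d k * b1 d k * b2 d k * b3 d k * b4 d * b5 d =
    Gamma (1-d) / (2 * (1-d) ^ 2) * (Gamma (3-3*d) * Gamma (4-5*d) / (Gamma (4-4*d) * Gamma (6-5*d)))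
      * tm d k := by
  have q1 := poch_pos' (a := 2-2*d) (by linarith) k
  have q3 := poch_pos' (a := 2-d) (by linarith) k
  have q4 := poch_pos' (a := 3-2*d) (by linarith) k
  have q5 := poch_pos' (a := 4-4*d) (by linarith) k
  have g1 := Gamma_pos_of_pos (s := 1-d) (by linarith)
  have g2 := Gamma_pos_of_pos (s := 3-3*d) (by linarith)
  have g3 := Gamma_pos_of_pos (s := 4-5*d) (by linarith)
  have g4 := Gamma_pos_of_pos (s := 4-4*d) (by linarith)
  have hk : (0:ℝ) ≤ k := by positivity
  have r1 := poch_ratio (a := 2-2*d) (by linarith) k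
  rw [show 2 - 2*d + 1 = 3 - 2*d by ring] at r1
  have e6 : Gamma (6-5*d) = (5-5*d) * ((4-5*d) * Gamma (4-5*d)) := by
    rw [show 6-5*d = (4-5*d+1)+1 by ring, Gamma_add_one (by linarith), Gamma_add_one (by linarith)]
    ring
  have e1 : b1 d k = k.factorial / ((1-d) * poch (2-d) k) := by
    rw [b1, ProbabilityTheory.beta, Gamma_nat_eq_factorial,
      show (k:ℝ)+1+(1-d) = (2-d)+k by ring, Gamma_poch (by linarith),
      show 2-d = (1-d)+1 by ring, Gamma_add_one (by linarith)]
    rw [show (1-d)+1 = 2-d by ring]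
    field_simp
  have e2 : b2 d k = (poch (2-2*d) k / poch (3-2*d) k) / (2-2*d) := by
    rw [b2, beta_one' (by linarith), r1]
    have : 2-2*d ≠ 0 := by linarith
    have : 2-2*d+k ≠ 0 := by linarith
    rw [show (k:ℝ)+2-2*d = 2-2*d+k by ring]
    clear r1
    generalize 2-2*d = q at *
    field_simp
  have e3 : b3 d k = poch (3-3*d) k * Gamma (3-3*d) * Gamma (1-d) / (poch (4-4*d) k * Gamma (4-4*d)) := by
    rw [b3, ProbabilityTheory.beta, show (k:ℝ)+3-3*d+(1-d) = (4-4*d)+k by ring,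
      show (k:ℝ)+3-3*d = (3-3*d)+k by ring, Gamma_poch (by linarith), Gamma_poch (by linarith)]
  rw [cf, e1, e2, e3, b4, b5, beta_one' (by linarith), beta_one' (by linarith), e6, tm, poch_one']
  have n1 : 1-d ≠ 0 := by linarith
  have n2 : 4-5*d ≠ 0 := by linarith
  have n3 : 5-5*d ≠ 0 := by linarith
  have hf : (k.factorial : ℝ) ≠ 0 := by positivity
  generalize Gamma (4-5*d) = G1 at *
  generalize Gamma (4-4*d) = G2 at *
  generalize Gamma (3-3*d) = G3 at *
  generalize Gamma (1-d) = G4 at *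
  generalize poch (4-4*d) k = p1 at *
  generalize poch (3-2*d) k = p2 at *
  generalize poch (2-2*d) k = p3 at *
  generalize poch (3-3*d) k = p4 at *
  generalize poch (2-d) k = p5 at *
  generalize (k.factorial : ℝ) = f at *
  rw [show 2-2*d = 2*(1-d) by ring]
  field_simp

noncomputable def Hf (d y1 y2 y3 y4 y5 : ℝ) : ENNReal :=
  if 0 < y5 ∧ y5 < y4 ∧ y4 < y3 ∧ y3 < y2 ∧ y2 < y1 ∧ y1 < 1 then
    ENNReal.ofReal ((y1 - y3) ^ (-d) * (y2 - y3) ^ (-d) * (y1 - y4) ^ (-d) * (y2 - y5) ^ (-d)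
      * (y4 - y5) ^ (-d)) else 0

noncomputable def Pf (d y1 x5 x4 x3 x2 : ℝ) : ENNReal :=
  if 0 < x2 ∧ x2 < x3 ∧ x3 < x4 ∧ x4 < x5 ∧ x5 < y1 ∧ y1 < 1 then
    ENNReal.ofReal (x3 ^ (-d) * (x3 - x2) ^ (-d) * x4 ^ (-d) * (x5 - x2) ^ (-d)
      * (x5 - x4) ^ (-d)) else 0

lemma Hf_eq (d y1 x5 x4 x3 x2 : ℝ) :
    Hf d y1 (y1 - x2) (y1 - x3) (y1 - x4) (y1 - x5) = Pf d y1 x5 x4 x3 x2 := by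
  unfold Hf Pf
  congr 1
  · apply propext
    constructor <;> rintro ⟨_, _, _, _, _, _⟩ <;> refine ⟨?_, ?_, ?_, ?_, ?_, ?_⟩ <;> linarith
  · congr 1
    ring_nf

lemma Hf_meas (d : ℝ) : Measurable fun p : ℝ × ℝ × ℝ × ℝ × ℝ =>
    Hf d p.1 p.2.1 p.2.2.1 p.2.2.2.1 p.2.2.2.2 := by
  unfold Hf
  refine Measurable.ite ?_ (by fun_prop) measurable_const
  simp only [ofPred_and]
  repeat' apply MeasurableSet.inter
  all_goals exact measurableSet_lt (by fun_prop) (by fun_prop)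

lemma comb (d x c : ℝ) : (c - x) ^ ((1:ℝ) - 1) = 1 := by simp

lemma L1 {d : ℝ} (h0 : 0 ≤ d) (h1 : d < 1/2) (y1 x5 x4 x3 : ℝ)
    (h : 0 < x3 ∧ x3 < x4 ∧ x4 < x5 ∧ x5 < y1 ∧ y1 < 1) :
    ∫⁻ x2, Pf d y1 x5 x4 x3 x2 = ∑' k : ℕ,
      ENNReal.ofReal (cf d k * b1 d k * x4 ^ (-d) * x5 ^ (-d-k) * (x5-x4) ^ (-d))
       * ENNReal.ofReal (x3 ^ ((k:ℝ)+2-2*d-1)) := by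
  obtain ⟨h3, h34, h45, h5, h6⟩ := h
  have p4 : 0 < x4 := by linarith
  have p5 : 0 < x5 := by linarith
  have p6 : 0 < x5 - x4 := by linarith
  have hcf : ∀ k, 0 ≤ cf d k := fun k => div_nonneg (poch_nonneg' h0 k) (by positivity)
  rw [lev (fun x2 => Pf d y1 x5 x4 x3 x2)
    (fun k => ENNReal.ofReal (cf d k * x3 ^ (-d) * x4 ^ (-d) * x5 ^ (-d-k) * (x5-x4) ^ (-d)))
    (fun k => (k:ℝ)+1) (1-d) x3 h3 (by linarith) (fun k => by positivity)]
  · congr 1; ext k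
    have hb : 0 ≤ b1 d k := (ProbabilityTheory.beta_pos (by positivity) (by linarith)).le
    have hc := hcf k
    rw [← b1, ← ENNReal.ofReal_mul (by positivity), ← ENNReal.ofReal_mul (by positivity)]
    congr 1
    rw [show (k:ℝ)+2-2*d-1 = -d + ((k:ℝ)+1+(1-d)-1) by ring, rpow_add h3]
    ring
  · rintro x ⟨hx, hx3⟩
    have p7 : 0 < x3 - x := by linarith
    have hs := (binom_series d (x/x5) (by positivity) ((div_lt_one p5).2 (by linarith))).mul_left
      (x3 ^ (-d) * (x3 - x) ^ (-d) * x4 ^ (-d) * x5 ^ (-d) * (x5 - x4) ^ (-d))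
    rw [Pf, if_pos ⟨hx, hx3, h34, h45, h5, h6⟩]
    have e : x3 ^ (-d) * (x3 - x) ^ (-d) * x4 ^ (-d) * (x5 - x) ^ (-d) * (x5 - x4) ^ (-d) =
       x3 ^ (-d) * (x3 - x) ^ (-d) * x4 ^ (-d) * x5 ^ (-d) * (x5 - x4) ^ (-d) 
         * (1 - x/x5) ^ (-d) := by
      rw [show x5 - x = x5 * (1 - x/x5) by field_simp, mul_rpow p5.le]
      · ring
      · rw [sub_nonneg, div_le_one p5]; linarith
    rw [e, ← hs.tsum_eq, ENNReal.ofReal_tsum_of_nonneg _ hs.summable]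
    · congr 1; ext k
      have hc := hcf k
      rw [← ENNReal.ofReal_mul (by positivity)]
      congr 1
      rw [show (k:ℝ)+1-1 = (k:ℝ) by ring, rpow_natCast, rpow_sub p5, rpow_natCast, div_pow,
        show 1-d-1 = -d by ring, cf]
      ring
    · intro k
      have hc := hcf k
      rw [cf] at hc
      positivity
  · intro x hx
    rw [Pf, if_neg]
    rintro ⟨a, b, _⟩
    exact hx ⟨a, b⟩

lemma L2 {d : ℝ} (h0 : 0 ≤ d) (h1 : d < 1/2) (y1 x5 x4 : ℝ)
    (h : 0 < x4 ∧ x4 < x5 ∧ x5 < y1 ∧ y1 < 1) :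
    ∫⁻ x3, ∫⁻ x2, Pf d y1 x5 x4 x3 x2 = ∑' k : ℕ,
      ENNReal.ofReal (cf d k * b1 d k * b2 d k * x5 ^ (-d-k))
       * ENNReal.ofReal (x4 ^ ((k:ℝ)+3-3*d-1) * (x5-x4) ^ ((1-d)-1)) := by
  obtain ⟨p4, h45, h5, h6⟩ := h
  have p5 : 0 < x5 := by linarith
  have p6 : 0 < x5 - x4 := by linarith
  have hcf : ∀ k, 0 ≤ cf d k := fun k => div_nonneg (poch_nonneg' h0 k) (by positivity)
  rw [lev (fun x3 => ∫⁻ x2, Pf d y1 x5 x4 x3 x2)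
    (fun k => ENNReal.ofReal (cf d k * b1 d k * x4 ^ (-d) * x5 ^ (-d-k) * (x5-x4) ^ (-d)))
    (fun k => (k:ℝ)+2-2*d) 1 x4 p4 (by linarith)
    (fun k => by have : (0:ℝ) ≤ k := by positivity
                 linarith)]
  · congr 1; ext k
    have hk : (0:ℝ) ≤ k := by positivity
    have hb : 0 ≤ b1 d k := (ProbabilityTheory.beta_pos (by positivity) (by linarith)).le
    have hb : 0 ≤ b2 d k := (ProbabilityTheory.beta_pos (by linarith) (by linarith)).le
    have hc := hcf k
    rw [← b2, ← ENNReal.ofReal_mul (by positivity), ← ENNReal.ofReal_mul (by positivity)]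
    congr 1
    rw [show (k:ℝ)+3-3*d-1 = -d + ((k:ℝ)+2-2*d+1-1) by ring, rpow_add p4,
        show 1-d-1 = -d by ring]
    ring
  · rintro x ⟨hx, hx3⟩
    rw [L1 h0 h1 _ _ _ _ ⟨hx, hx3, h45, h5, h6⟩]
    simp
  · intro x hx
    have : ∀ x2, Pf d y1 x5 x4 x x2 = 0 := fun x2 => by
      rw [Pf, if_neg]
      rintro ⟨a, b, c, _⟩
      exact hx ⟨by linarith, c⟩
    simp [this]

lemma L3 {d : ℝ} (h0 : 0 ≤ d) (h1 : d < 1/2) (y1 x5 : ℝ)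
    (h : 0 < x5 ∧ x5 < y1 ∧ y1 < 1) :
    ∫⁻ x4, ∫⁻ x3, ∫⁻ x2, Pf d y1 x5 x4 x3 x2 = ∑' k : ℕ,
      ENNReal.ofReal (cf d k * b1 d k * b2 d k * b3 d k)
       * ENNReal.ofReal (x5 ^ ((4-5*d)-1) * (y1-x5) ^ ((1:ℝ)-1)) := by
  obtain ⟨p5, h5, h6⟩ := h
  have hcf : ∀ k, 0 ≤ cf d k := fun k => div_nonneg (poch_nonneg' h0 k) (by positivity)
  rw [lev (fun x4 => ∫⁻ x3, ∫⁻ x2, Pf d y1 x5 x4 x3 x2)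
    (fun k => ENNReal.ofReal (cf d k * b1 d k * b2 d k * x5 ^ (-d-k)))
    (fun k => (k:ℝ)+3-3*d) (1-d) x5 p5 (by linarith)
    (fun k => by have : (0:ℝ) ≤ k := by positivity
                 linarith)]
  · congr 1; ext k
    have hk : (0:ℝ) ≤ k := by positivity
    have hb : 0 ≤ b1 d k := (ProbabilityTheory.beta_pos (by positivity) (by linarith)).le
    have hb : 0 ≤ b2 d k := (ProbabilityTheory.beta_pos (by linarith) (by linarith)).le
    have hb : 0 ≤ b3 d k := (ProbabilityTheory.beta_pos (by linarith) (by linarith)).le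
    have hc := hcf k
    rw [← b3, ← ENNReal.ofReal_mul (by positivity), ← ENNReal.ofReal_mul (by positivity)]
    congr 1
    rw [show (4-5*d)-1 = (-d-k) + ((k:ℝ)+3-3*d+(1-d)-1) by ring, rpow_add p5, sub_self, rpow_zero]
    ring
  · rintro x ⟨hx, hx3⟩
    rw [L2 h0 h1 _ _ _ ⟨hx, hx3, h5, h6⟩]
  · intro x hx
    have : ∀ x3 x2, Pf d y1 x5 x x3 x2 = 0 := fun x3 x2 => by
      rw [Pf, if_neg]
      rintro ⟨a, b, c, e, _⟩
      exact hx ⟨by linarith, e⟩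
    simp [this]

lemma L4 {d : ℝ} (h0 : 0 ≤ d) (h1 : d < 1/2) (y1 : ℝ)
    (h : 0 < y1 ∧ y1 < 1) :
    ∫⁻ x5, ∫⁻ x4, ∫⁻ x3, ∫⁻ x2, Pf d y1 x5 x4 x3 x2 = ∑' k : ℕ,
      ENNReal.ofReal (cf d k * b1 d k * b2 d k * b3 d k * b4 d)
       * ENNReal.ofReal (y1 ^ ((5-5*d)-1) * (1-y1) ^ ((1:ℝ)-1)) := by
  obtain ⟨p5, h6⟩ := h
  have hcf : ∀ k, 0 ≤ cf d k := fun k => div_nonneg (poch_nonneg' h0 k) (by positivity)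
  rw [lev (fun x5 => ∫⁻ x4, ∫⁻ x3, ∫⁻ x2, Pf d y1 x5 x4 x3 x2)
    (fun k => ENNReal.ofReal (cf d k * b1 d k * b2 d k * b3 d k))
    (fun k => 4-5*d) 1 y1 p5 (by linarith) (fun k => by linarith)]
  · congr 1; ext k
    have hk : (0:ℝ) ≤ k := by positivity
    have hb : 0 ≤ b1 d k := (ProbabilityTheory.beta_pos (by positivity) (by linarith)).le
    have hb : 0 ≤ b2 d k := (ProbabilityTheory.beta_pos (by linarith) (by linarith)).le
    have hb : 0 ≤ b3 d k := (ProbabilityTheory.beta_pos (by linarith) (by linarith)).le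
    have hb : 0 ≤ b4 d := (ProbabilityTheory.beta_pos (by linarith) (by linarith)).le
    have hc := hcf k
    rw [← b4, ← ENNReal.ofReal_mul (by positivity), ← ENNReal.ofReal_mul (by positivity)]
    congr 1
    rw [show (5-5*d)-1 = 4-5*d+1-1 by ring, sub_self, rpow_zero]
    ring
  · rintro x ⟨hx, hx3⟩
    rw [L3 h0 h1 _ _ ⟨hx, hx3, h6⟩]
  · intro x hx
    have : ∀ x4 x3 x2, Pf d y1 x x4 x3 x2 = 0 := fun x4 x3 x2 => by
      rw [Pf, if_neg]
      rintro ⟨a, b, c, e, f, _⟩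
      exact hx ⟨by linarith, f⟩
    simp [this]

lemma L5 {d : ℝ} (h0 : 0 ≤ d) (h1 : d < 1/2) :
    ∫⁻ y1, ∫⁻ x5, ∫⁻ x4, ∫⁻ x3, ∫⁻ x2, Pf d y1 x5 x4 x3 x2 = ∑' k : ℕ,
      ENNReal.ofReal (cf d k * b1 d k * b2 d k * b3 d k * b4 d * b5 d) := by
  have hcf : ∀ k, 0 ≤ cf d k := fun k => div_nonneg (poch_nonneg' h0 k) (by positivity)
  rw [lev (fun y1 => ∫⁻ x5, ∫⁻ x4, ∫⁻ x3, ∫⁻ x2, Pf d y1 x5 x4 x3 x2)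
    (fun k => ENNReal.ofReal (cf d k * b1 d k * b2 d k * b3 d k * b4 d))
    (fun k => 5-5*d) 1 1 one_pos (by linarith) (fun k => by linarith)]
  · congr 1; ext k
    have hk : (0:ℝ) ≤ k := by positivity
    have hb : 0 ≤ b1 d k := (ProbabilityTheory.beta_pos (by positivity) (by linarith)).le
    have hb : 0 ≤ b2 d k := (ProbabilityTheory.beta_pos (by linarith) (by linarith)).le
    have hb : 0 ≤ b3 d k := (ProbabilityTheory.beta_pos (by linarith) (by linarith)).le
    have hb : 0 ≤ b4 d := (ProbabilityTheory.beta_pos (by linarith) (by linarith)).le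
    have hc := hcf k
    rw [← b5, ← ENNReal.ofReal_mul (by positivity), one_rpow, one_mul]
  · rintro x ⟨hx, hx3⟩
    rw [L4 h0 h1 _ ⟨hx, hx3⟩]
  · intro x hx
    have : ∀ x5 x4 x3 x2, Pf d x x5 x4 x3 x2 = 0 := fun x5 x4 x3 x2 => by
      rw [Pf, if_neg]
      rintro ⟨a, b, c, e, f, g⟩
      exact hx ⟨by linarith, g⟩
    simp [this]

lemma Ltot {d : ℝ} (h0 : 0 ≤ d) (h1 : d < 1/2) :
    ∫⁻ y1, ∫⁻ y2, ∫⁻ y3, ∫⁻ y4, ∫⁻ y5, Hf d y1 y2 y3 y4 y5 =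
    ENNReal.ofReal (Gamma (1-d) / (2 * (1-d) ^ 2) *
      (Gamma (3-3*d) * Gamma (4-5*d) / (Gamma (4-4*d) * Gamma (6-5*d))) *
      F43 1 d (2-2*d) (3-3*d) (2-d) (3-2*d) (4-4*d)) := by
  have e1 : ∀ y1, ∫⁻ y2, ∫⁻ y3, ∫⁻ y4, ∫⁻ y5, Hf d y1 y2 y3 y4 y5 =
      ∫⁻ x5, ∫⁻ x4, ∫⁻ x3, ∫⁻ x2, Pf d y1 x5 x4 x3 x2 := by
    intro y1
    rw [← swap4 (fun x2 x3 x4 x5 => Pf d y1 x5 x4 x3 x2)]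
    · rw [reflI _ y1]
      congr 1; ext x2
      rw [reflI _ y1]
      congr 1; ext x3
      rw [reflI _ y1]
      congr 1; ext x4
      rw [reflI _ y1]
      congr 1; ext x5
      exact Hf_eq ..
    · simp_rw [← Hf_eq]
      exact (Hf_meas d).comp (f := fun p : ℝ × ℝ × ℝ × ℝ =>
        (y1, y1 - p.1, y1 - p.2.1, y1 - p.2.2.1, y1 - p.2.2.2)) (by fun_prop)
  simp_rw [e1]
  rw [L5 h0 h1]
  simp_rw [term_eq h0 h1]
  have g1 := Gamma_pos_of_pos (s := 1-d) (by linarith)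
  have g2 := Gamma_pos_of_pos (s := 3-3*d) (by linarith)
  have g3 := Gamma_pos_of_pos (s := 4-5*d) (by linarith)
  have g4 := Gamma_pos_of_pos (s := 4-4*d) (by linarith)
  have g5 := Gamma_pos_of_pos (s := 6-5*d) (by linarith)
  rw [← ENNReal.ofReal_tsum_of_nonneg _ ((tm_summable h0 h1).mul_left _), tsum_mul_left]
  · rfl
  · intro k
    have := tm_nonneg h0 h1 k
    positivity

lemma M4 (d : ℝ) : Measurable fun p : ℝ × ℝ × ℝ × ℝ =>
    ∫⁻ y5, Hf d p.1 p.2.1 p.2.2.1 p.2.2.2 y5 :=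
  Measurable.lintegral_prod_right'
    (f := fun p : (ℝ × ℝ × ℝ × ℝ) × ℝ => Hf d p.1.1 p.1.2.1 p.1.2.2.1 p.1.2.2.2 p.2)
    ((Hf_meas d).comp (f := fun p : (ℝ × ℝ × ℝ × ℝ) × ℝ =>
      (p.1.1, p.1.2.1, p.1.2.2.1, p.1.2.2.2, p.2)) (by fun_prop))

lemma M3 (d : ℝ) : Measurable fun p : ℝ × ℝ × ℝ =>
    ∫⁻ y4, ∫⁻ y5, Hf d p.1 p.2.1 p.2.2 y4 y5 :=
  Measurable.lintegral_prod_right'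
    (f := fun p : (ℝ × ℝ × ℝ) × ℝ => ∫⁻ y5, Hf d p.1.1 p.1.2.1 p.1.2.2 p.2 y5)
    ((M4 d).comp (f := fun p : (ℝ × ℝ × ℝ) × ℝ =>
      (p.1.1, p.1.2.1, p.1.2.2, p.2)) (by fun_prop))

lemma M2 (d : ℝ) : Measurable fun p : ℝ × ℝ =>
    ∫⁻ y3, ∫⁻ y4, ∫⁻ y5, Hf d p.1 p.2 y3 y4 y5 :=
  Measurable.lintegral_prod_right'
    (f := fun p : (ℝ × ℝ) × ℝ => ∫⁻ y4, ∫⁻ y5, Hf d p.1.1 p.1.2 p.2 y4 y5)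
    ((M3 d).comp (f := fun p : (ℝ × ℝ) × ℝ => (p.1.1, p.1.2, p.2)) (by fun_prop))

lemma M1 (d : ℝ) : Measurable fun p : ℝ =>
    ∫⁻ y2, ∫⁻ y3, ∫⁻ y4, ∫⁻ y5, Hf d p y2 y3 y4 y5 :=
  Measurable.lintegral_prod_right'
    (f := fun p : ℝ × ℝ => ∫⁻ y3, ∫⁻ y4, ∫⁻ y5, Hf d p.1 p.2 y3 y4 y5) (M2 d)

theorem stmt15 (d : ℝ) (h0 : 0 ≤ d) (h1 : d < 1/2) :
    (∫ y1 in (0:ℝ)..1, ∫ y2 in (0:ℝ)..y1, ∫ y3 in (0:ℝ)..y2, ∫ y4 in (0:ℝ)..y3, ∫ y5 in (0:ℝ)..y4,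
      (y1 - y3) ^ (-d) * (y2 - y3) ^ (-d) * (y1 - y4) ^ (-d) * (y2 - y5) ^ (-d) * (y4 - y5) ^ (-d)) =
    Gamma (1-d) / (2 * (1-d) ^ 2) * (Gamma (3-3*d) * Gamma (4-5*d) / (Gamma (4-4*d) * Gamma (6-5*d))) *
      F43 1 d (2-2*d) (3-3*d) (2-d) (3-2*d) (4-4*d) := by
  have g1 := Gamma_pos_of_pos (s := 1-d) (by linarith)
  have g2 := Gamma_pos_of_pos (s := 3-3*d) (by linarith)
  have g3 := Gamma_pos_of_pos (s := 4-5*d) (by linarith)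
  have g4 := Gamma_pos_of_pos (s := 4-4*d) (by linarith)
  have g5 := Gamma_pos_of_pos (s := 6-5*d) (by linarith)
  have hF : 0 ≤ F43 1 d (2-2*d) (3-3*d) (2-d) (3-2*d) (4-4*d) := tsum_nonneg (tm_nonneg h0 h1)
  have hT := Ltot h0 h1
  rw [← ENNReal.toReal_ofReal (r := _ * F43 _ _ _ _ _ _ _) (by positivity), ← hT]
  refine step _ _ 1 zero_le_one (M1 d) ?_ ?_ (by rw [hT]; exact ENNReal.ofReal_lt_top)
  swap
  · intro y1 hy
    have : ∀ y2 y3 y4 y5, Hf d y1 y2 y3 y4 y5 = 0 := fun y2 y3 y4 y5 => by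
      rw [Hf, if_neg]
      rintro ⟨_, _, _, _, _, _⟩
      exact hy ⟨by linarith, by linarith⟩
    simp [this]
  rintro y1 ⟨a1, c1⟩ f1
  refine step _ _ y1 a1.le ((M2 d).comp (f := fun y => (y1, y)) (by fun_prop)) ?_ ?_ f1
  swap
  · intro y2 hy
    have : ∀ y3 y4 y5, Hf d y1 y2 y3 y4 y5 = 0 := fun y3 y4 y5 => by
      rw [Hf, if_neg]
      rintro ⟨_, _, _, _, _, _⟩
      exact hy ⟨by linarith, by linarith⟩
    simp [this]
  rintro y2 ⟨a2, c2⟩ f2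
  refine step _ _ y2 a2.le ((M3 d).comp (f := fun y => (y1, y2, y)) (by fun_prop)) ?_ ?_ f2
  swap
  · intro y3 hy
    have : ∀ y4 y5, Hf d y1 y2 y3 y4 y5 = 0 := fun y4 y5 => by
      rw [Hf, if_neg]
      rintro ⟨_, _, _, _, _, _⟩
      exact hy ⟨by linarith, by linarith⟩
    simp [this]
  rintro y3 ⟨a3, c3⟩ f3
  refine step _ _ y3 a3.le ((M4 d).comp (f := fun y => (y1, y2, y3, y)) (by fun_prop)) ?_ ?_ f3
  swap
  · intro y4 hy
    have : ∀ y5, Hf d y1 y2 y3 y4 y5 = 0 := fun y5 => by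
      rw [Hf, if_neg]
      rintro ⟨_, _, _, _, _, _⟩
      exact hy ⟨by linarith, by linarith⟩
    simp [this]
  rintro y4 ⟨a4, c4⟩ f4
  refine step _ _ y4 a4.le ((Hf_meas d).comp (f := fun y => (y1, y2, y3, y4, y)) (by fun_prop))
    ?_ ?_ f4
  swap
  · intro y5 hy
    rw [Hf, if_neg]
    rintro ⟨_, _, _, _, _, _⟩
    exact hy ⟨by linarith, by linarith⟩
  rintro y5 ⟨a5, c5⟩ f5
  rw [Hf, if_pos ⟨a5, c5, c4, c3, c2, c1⟩, ENNReal.toReal_ofReal]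
  have : 0 < y1 - y3 := by linarith
  have : 0 < y2 - y3 := by linarith
  have : 0 < y1 - y4 := by linarith
  have : 0 < y2 - y5 := by linarith
  have : 0 < y4 - y5 := by linarith
  positivity
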